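/- arXiv:1607.08754 — 2 statements merged into one kernel-verified Lean document; each statement's English description precedes it below -/
import Mathlib

section
/- Let G be a finite simple graph with n vertices, Π_p a partial k-coloring of G with classes C_1,…,C_k, and k0 ≥ k with M := max_{1≤i≤k}|C_i| ≤ ⌈n/k0⌉ (set C_i := ∅ for i > k). Suppose the uncolored set U is partitioned into sets U^1,…,U^l such that each U^j is a clique in G and there is no edge of G between U^j and U^{j'} for j ≠ j'. Then Π_p extends to an equitable k0-coloring if and only if there exists a map g : U → {1,…,k0} such that (i) g(v) ∈ F(v) for every v ∈ U, (ii) for every j ∈ {1,…,l} and every color i, at most one vertex v ∈ U^j has g(v) = i, and (iii) ⌊n/k0⌋ − |C_i| ≤ |{v ∈ U : g(v) = i}| ≤ ⌈n/k0⌉ − |C_i| for every i ∈ {1,…,k0} (equivalently, the network N(G,Π_p,k0) with α^j = 1 admits an admissible integral flow of value |U|). -/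
open Finset

variable {V : Type*}

/-- A `k`-coloring of `G`: `k` pairwise disjoint independent (possibly empty) classes covering `V`. -/
def IsColoring (G : SimpleGraph V) (k : ℕ) (C : Fin k → Finset V) : Prop :=
  (∀ i j : Fin k, i ≠ j → Disjoint (C i) (C j)) ∧
  (∀ i : Fin k, ∀ v ∈ C i, ∀ w ∈ C i, ¬ G.Adj v w) ∧
  (∀ v : V, ∃ i : Fin k, v ∈ C i)

/-- A coloring is equitable if the sizes of any two color classes differ by at most one. -/
def IsEquitable {k : ℕ} (C : Fin k → Finset V) : Prop :=
  ∀ i j : Fin k, (C i).card ≤ (C j).card + 1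

/-- A partial `k`-coloring of `G`: `k` pairwise disjoint independent classes. -/
def IsPartialColoring (G : SimpleGraph V) (k : ℕ) (C : Fin k → Finset V) : Prop :=
  (∀ i j : Fin k, i ≠ j → Disjoint (C i) (C j)) ∧
  (∀ i : Fin k, ∀ v ∈ C i, ∀ w ∈ C i, ¬ G.Adj v w)

/-- The classes extended to `k0` colors: `C i` for `i < k` and `∅` for `i ≥ k`. -/
def Cext (k k0 : ℕ) (C : Fin k → Finset V) : Fin k0 → Finset V :=
  fun i => if h : (i : ℕ) < k then C ⟨i, h⟩ else ∅

/-- The set `U` of uncolored vertices of a partial coloring. -/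
def uncolored [Fintype V] [DecidableEq V] {k : ℕ} (C : Fin k → Finset V) : Finset V :=
  univ \ univ.biUnion fun i => C i

/-- `F(v)`: the free colors of `v`, i.e. colors `i ≤ k0` such that `v` has no neighbor in `C i`. -/
def freeColors (G : SimpleGraph V) [DecidableRel G.Adj] (k k0 : ℕ)
    (C : Fin k → Finset V) (v : V) : Finset (Fin k0) :=
  univ.filter fun i : Fin k0 => ∀ w ∈ Cext k k0 C i, ¬ G.Adj v w

lemma mem_uncolored [Fintype V] [DecidableEq V] {k : ℕ} {C : Fin k → Finset V} {v : V} :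
    v ∈ uncolored C ↔ ∀ i, v ∉ C i := by
  simp [uncolored]

lemma mem_Cext {k k0 : ℕ} {C : Fin k → Finset V} {i : Fin k0} {v : V} :
    v ∈ Cext k k0 C i ↔ ∃ h : (i : ℕ) < k, v ∈ C ⟨i, h⟩ := by
  unfold Cext
  split_ifs with h <;> simp [h]

lemma disjoint_Cext_uncolored [Fintype V] [DecidableEq V] {k k0 : ℕ} (C : Fin k → Finset V)
    (i : Fin k0) : Disjoint (Cext k k0 C i) (uncolored C) := by
  rw [Finset.disjoint_left]
  intro v hv hU
  obtain ⟨h, hv⟩ := mem_Cext.1 hv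
  exact mem_uncolored.1 hU _ hv

lemma card_Cext_union_filter [Fintype V] [DecidableEq V] {k k0 : ℕ} (C : Fin k → Finset V)
    (g : V → Fin k0) (i : Fin k0) :
    (Cext k k0 C i ∪ (uncolored C).filter fun v => g v = i).card =
      (Cext k k0 C i).card + ((uncolored C).filter fun v => g v = i).card :=
  card_union_of_disjoint ((disjoint_Cext_uncolored C i).mono_right (filter_subset _ _))

lemma IsColoring.sum_card [Fintype V] {G : SimpleGraph V} {k : ℕ} {D : Fin k → Finset V}
    (hD : IsColoring G k D) : ∑ i, (D i).card = Fintype.card V := by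
  classical
  rw [← card_biUnion fun i _ j _ hij => hD.1 i j hij, ← card_univ]
  congr 1
  ext v
  simpa using hD.2.2 v

lemma IsColoring.card_bounds [Fintype V] {G : SimpleGraph V} {k : ℕ} {D : Fin k → Finset V}
    (hD : IsColoring G k D) (hE : IsEquitable D) (i : Fin k) :
    Fintype.card V / k ≤ (D i).card ∧ (D i).card ≤ (Fintype.card V + k - 1) / k := by
  have hk : 0 < k := i.pos
  have hsum := hD.sum_card
  constructor
  · by_contra! h
    have hlt : ∑ j, (D j).card < ∑ _j : Fin k, Fintype.card V / k :=
      sum_lt_sum (fun j _ => by have := hE j i; omega) ⟨i, mem_univ i, h⟩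
    rw [hsum, sum_const, card_univ, Fintype.card_fin, smul_eq_mul] at hlt
    have := Nat.mul_div_le (Fintype.card V) k
    omega
  · by_contra! h
    have hlt : ∑ _j : Fin k, (Fintype.card V + k - 1) / k < ∑ j, (D j).card :=
      sum_lt_sum (fun j _ => by have := hE i j; omega) ⟨i, mem_univ i, h⟩
    rw [hsum, sum_const, card_univ, Fintype.card_fin, smul_eq_mul] at hlt
    have h1 := Nat.div_add_mod (Fintype.card V + k - 1) k
    have h2 := Nat.mod_lt (Fintype.card V + k - 1) hk
    omega

lemma Nat.add_sub_one_div_le (n : ℕ) {k : ℕ} (hk : 0 < k) : (n + k - 1) / k ≤ n / k + 1 := by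
  rw [← Nat.add_div_right n hk]
  exact Nat.div_le_div_right (by omega)

theorem stmt6 [Fintype V] [DecidableEq V] (G : SimpleGraph V) [DecidableRel G.Adj]
    (k k0 : ℕ) (hk : k ≤ k0) (C : Fin k → Finset V) (hC : IsPartialColoring G k C)
    (hM : (univ.sup fun i : Fin k => (C i).card) ≤ (Fintype.card V + k0 - 1) / k0)
    (l : ℕ) (P : Fin l → Finset V)
    (hPdisj : ∀ j j' : Fin l, j ≠ j' → Disjoint (P j) (P j'))
    (hPcover : univ.biUnion P = uncolored C)
    (hclique : ∀ j : Fin l, ∀ v ∈ P j, ∀ w ∈ P j, v ≠ w → G.Adj v w)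
    (hnoedge : ∀ j j' : Fin l, j ≠ j' → ∀ v ∈ P j, ∀ w ∈ P j', ¬ G.Adj v w) :
    (∃ D : Fin k0 → Finset V, IsColoring G k0 D ∧ IsEquitable D ∧
        ∀ i : Fin k, C i ⊆ D (Fin.castLE hk i)) ↔
      ∃ g : V → Fin k0,
        (∀ v ∈ uncolored C, g v ∈ freeColors G k k0 C v) ∧
        (∀ j : Fin l, ∀ i : Fin k0, ((P j).filter fun v => g v = i).card ≤ 1) ∧
        (∀ i : Fin k0,
          ((Fintype.card V / k0 : ℕ) : ℤ) - ((Cext k k0 C i).card : ℤ)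
              ≤ ((((uncolored C).filter fun v => g v = i)).card : ℤ) ∧
          ((((uncolored C).filter fun v => g v = i)).card : ℤ)
              ≤ (((Fintype.card V + k0 - 1) / k0 : ℕ) : ℤ) - ((Cext k k0 C i).card : ℤ)) := by
  constructor
  · rintro ⟨D, hD, hE, hCD⟩
    choose g hg using hD.2.2
    have huniq : ∀ v i, v ∈ D i → g v = i := fun v i hv => by
      by_contra h
      exact Finset.disjoint_left.1 (hD.1 _ _ h) (hg v) hv
    have hCext : ∀ i, Cext k k0 C i ⊆ D i := fun i v hv => by
      obtain ⟨h, hv⟩ := mem_Cext.1 hv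
      exact hCD _ hv
    refine ⟨g, fun v _ => ?_, fun j i => ?_, fun i => ?_⟩
    · simp only [freeColors, mem_filter, mem_univ, true_and]
      exact fun w hw => hD.2.1 _ v (hg v) w (hCext _ hw)
    · rw [card_le_one]
      intro v hv w hw
      rw [mem_filter] at hv hw
      by_contra hne
      exact hD.2.1 i v (hv.2 ▸ hg v) w (hw.2 ▸ hg w) (hclique j v hv.1 w hw.1 hne)
    · have hDi : D i = Cext k k0 C i ∪ (uncolored C).filter fun v => g v = i := by
        ext v
        rw [mem_union, mem_filter]
        constructor
        · intro hv
          by_cases hU : v ∈ uncolored C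
          · exact Or.inr ⟨hU, huniq v i hv⟩
          · rw [mem_uncolored] at hU
            push Not at hU
            obtain ⟨j, hj⟩ := hU
            have hji : Fin.castLE hk j = i :=
              (huniq v _ (hCD j hj)).symm.trans (huniq v i hv)
            subst hji
            exact Or.inl (mem_Cext.2 ⟨j.2, hj⟩)
        · rintro (hv | ⟨-, rfl⟩)
          · exact hCext i hv
          · exact hg v
      have hb := hD.card_bounds hE i
      rw [hDi, card_Cext_union_filter] at hb
      omega
  · rintro ⟨g, hfree, hone, hcard⟩
    have hcross : ∀ i, ∀ v ∈ Cext k k0 C i, ∀ w ∈ (uncolored C).filter fun v => g v = i,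
        ¬ G.Adj w v := fun i v hv w hw => by
      rw [mem_filter] at hw
      have := hfree w hw.1
      simp only [freeColors, mem_filter, mem_univ, true_and, hw.2] at this
      exact this v hv
    refine ⟨fun i => Cext k k0 C i ∪ (uncolored C).filter fun v => g v = i,
      ⟨fun i j hij => ?_, fun i v hv w hw hadj => ?_, fun v => ?_⟩, fun i j => ?_, fun i v hv => ?_⟩
    · rw [Finset.disjoint_left]
      intro v hv hw
      rw [mem_union, mem_filter] at hv hw
      rcases hv with hv | hv <;> rcases hw with hw | hw
      · obtain ⟨hi, hv⟩ := mem_Cext.1 hv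
        obtain ⟨hj, hw⟩ := mem_Cext.1 hw
        refine Finset.disjoint_left.1 (hC.1 _ _ fun h => hij ?_) hv hw
        simpa [Fin.ext_iff] using h
      · exact Finset.disjoint_left.1 (disjoint_Cext_uncolored C i) hv hw.1
      · exact Finset.disjoint_left.1 (disjoint_Cext_uncolored C j) hw hv.1
      · exact hij (hv.2.symm.trans hw.2)
    · rcases mem_union.1 hv with hv | hv <;> rcases mem_union.1 hw with hw | hw
      · obtain ⟨hi, hv⟩ := mem_Cext.1 hv
        obtain ⟨_, hw⟩ := mem_Cext.1 hw
        exact hC.2 _ v hv w hw hadj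
      · exact hcross i v hv w hw hadj.symm
      · exact hcross i w hw v hv hadj
      · rw [mem_filter, ← hPcover, mem_biUnion] at hv hw
        obtain ⟨⟨a, -, ha⟩, hvi⟩ := hv
        obtain ⟨⟨b, -, hb⟩, hwi⟩ := hw
        by_cases hab : a = b
        · subst hab
          exact hadj.ne (card_le_one.1 (hone a i) v (mem_filter.2 ⟨ha, hvi⟩) w
            (mem_filter.2 ⟨hb, hwi⟩))
        · exact hnoedge a b hab v ha w hb hadj
    · by_cases hU : v ∈ uncolored C
      · exact ⟨g v, mem_union_right _ (mem_filter.2 ⟨hU, rfl⟩)⟩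
      · rw [mem_uncolored] at hU
        push Not at hU
        obtain ⟨j, hj⟩ := hU
        exact ⟨Fin.castLE hk j, mem_union_left _ (mem_Cext.2 ⟨j.2, hj⟩)⟩
    · rw [card_Cext_union_filter, card_Cext_union_filter]
      have h1 := (hcard i).2
      have h2 := (hcard j).1
      have h3 := Nat.add_sub_one_div_le (Fintype.card V) i.pos
      omega
    · exact mem_union_left _ (mem_Cext.2 ⟨i.2, hv⟩)
end

section
/- Let G be a finite simple graph with n vertices, Π_p a partial k-coloring of G with classes C_1,…,C_k (C_i := ∅ for i > k), uncolored set U, and let k0 ≥ k. If Π_p extends to an equitable k0-coloring, then for every set of colors T ⊆ {1,…,k0}: Σ_{i∈T}(⌊n/k0⌋ − |C_i|) ≤ |{v ∈ U : F(v) ∩ T ≠ ∅}| (the sum taken in ℤ). -/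
open Finset

variable {V : Type*}

theorem IsColoring.card_div_le_card [Fintype V] [DecidableEq V] {G : SimpleGraph V} {m : ℕ}
    {D : Fin m → Finset V} (hD : IsColoring G m D) (hE : IsEquitable D) (i : Fin m) :
    Fintype.card V / m ≤ (D i).card := by
  have hcover : univ.biUnion D = univ := by
    ext v
    simpa using hD.2.2 v
  have hsum : Fintype.card V = ∑ j, (D j).card := by
    rw [← card_univ, ← hcover, card_biUnion fun a _ b _ hab => hD.1 a b hab]
  by_contra! hlt
  have hstrict : ∑ j, (D j).card < ∑ _j : Fin m, Fintype.card V / m := by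
    refine sum_lt_sum (fun j _ => ?_) ⟨i, mem_univ i, hlt⟩
    have := hE j i
    omega
  rw [sum_const, card_univ, Fintype.card_fin, smul_eq_mul, ← hsum] at hstrict
  exact absurd (Nat.mul_div_le (Fintype.card V) m) hstrict.not_ge

theorem Cext_castLE {k k0 : ℕ} (hk : k ≤ k0) (C : Fin k → Finset V) (j : Fin k) :
    Cext k k0 C (Fin.castLE hk j) = C j := by
  simp [Cext]

theorem Cext_subset {k k0 : ℕ} (hk : k ≤ k0) {C : Fin k → Finset V} {D : Fin k0 → Finset V}
    (hCD : ∀ i : Fin k, C i ⊆ D (Fin.castLE hk i)) (i : Fin k0) : Cext k k0 C i ⊆ D i := by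
  unfold Cext
  split_ifs with h
  · exact hCD ⟨i, h⟩
  · exact empty_subset _

theorem sdiff_Cext_subset_uncolored [Fintype V] [DecidableEq V] {k k0 : ℕ} (hk : k ≤ k0)
    {C : Fin k → Finset V} {D : Fin k0 → Finset V}
    (hdisj : ∀ i j : Fin k0, i ≠ j → Disjoint (D i) (D j))
    (hCD : ∀ i : Fin k, C i ⊆ D (Fin.castLE hk i)) (i : Fin k0) :
    D i \ Cext k k0 C i ⊆ uncolored C := by
  intro v hv
  rw [mem_sdiff] at hv
  simp only [uncolored, mem_sdiff, mem_univ, mem_biUnion, true_and, not_exists]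
  intro j hj
  by_cases hij : i = Fin.castLE hk j
  · subst hij
    exact hv.2 (by rwa [Cext_castLE])
  · exact disjoint_left.mp (hdisj _ _ hij) hv.1 (hCD j hj)

theorem stmt15 [Fintype V] [DecidableEq V] (G : SimpleGraph V) [DecidableRel G.Adj]
    (k k0 : ℕ) (hk : k ≤ k0) (C : Fin k → Finset V) (hC : IsPartialColoring G k C)
    (hext : ∃ D : Fin k0 → Finset V, IsColoring G k0 D ∧ IsEquitable D ∧
      ∀ i : Fin k, C i ⊆ D (Fin.castLE hk i)) :
    ∀ T : Finset (Fin k0),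
      ∑ i ∈ T, (((Fintype.card V / k0 : ℕ) : ℤ) - ((Cext k k0 C i).card : ℤ))
        ≤ ((((uncolored C).filter fun v =>
            (freeColors G k k0 C v ∩ T).Nonempty)).card : ℤ) := by
  intro T
  obtain ⟨D, hD, hE, hCD⟩ := hext
  have hsub : (T.biUnion fun i => D i \ Cext k k0 C i) ⊆
      (uncolored C).filter fun v => (freeColors G k k0 C v ∩ T).Nonempty := by
    intro v hv
    obtain ⟨i, hiT, hvi⟩ := mem_biUnion.mp hv
    refine mem_filter.mpr ⟨sdiff_Cext_subset_uncolored hk hD.1 hCD i hvi, i, ?_⟩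
    simp only [mem_inter, freeColors, mem_filter_univ]
    refine ⟨fun w hw => ?_, hiT⟩
    exact hD.2.1 i v (mem_sdiff.mp hvi).1 w (Cext_subset hk hCD i hw)
  have hcard : (T.biUnion fun i => D i \ Cext k k0 C i).card =
      ∑ i ∈ T, (D i \ Cext k k0 C i).card :=
    card_biUnion fun a _ b _ hab => (hD.1 a b hab).mono sdiff_subset sdiff_subset
  calc ∑ i ∈ T, (((Fintype.card V / k0 : ℕ) : ℤ) - ((Cext k k0 C i).card : ℤ))
      ≤ ∑ i ∈ T, ((D i \ Cext k k0 C i).card : ℤ) := by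
        refine sum_le_sum fun i _ => ?_
        have h₁ := hD.card_div_le_card hE i
        have h₂ := card_sdiff_add_card_eq_card (Cext_subset hk hCD i)
        omega
    _ = ((T.biUnion fun i => D i \ Cext k k0 C i).card : ℤ) := by
        rw [hcard, Nat.cast_sum]
    _ ≤ _ := by exact_mod_cast card_le_card hsub
end
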